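/- arXiv:1712.06363 — 2 statements merged into one kernel-verified Lean document; each statement's English description precedes it below -/
import Mathlib

section
/- Let X be a simple graph as in the context and let α = (M + √(M² + 4M))/2. Then for every complex number u with |u| < 1/α, the series Σ_{m=0}^{∞} (Σ_{k=0}^{⌊m/2⌋} C_{m−2k}) u^m converges in operator norm and (Σ_{m=0}^{∞} (Σ_{k=0}^{⌊m/2⌋} C_{m−2k}) u^m)(I − uA_X + u²Q_X) = I. -/
noncomputable section

/-- The Hilbert space `ℓ²(V)` of square-summable complex functions on `V`. -/
abbrev ℓ2 (V : Type) : Type := lp (fun _ : V => ℂ) 2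

namespace SimpleGraph

variable {V : Type} (G : SimpleGraph V)

/-- The degree of a vertex. -/
def gdeg (v : V) : ℕ := Nat.card (G.neighborSet v)

/-- A geodesic (non-backtracking) path of length `m` in a simple graph,
encoded as its sequence of `m + 1` vertices. -/
def IsGeoPath {m : ℕ} (p : Fin (m + 1) → V) : Prop :=
  (∀ (i : ℕ) (h : i + 1 < m + 1), G.Adj (p ⟨i, by omega⟩) (p ⟨i + 1, h⟩)) ∧
  (∀ (i : ℕ) (h : i + 2 < m + 1), p ⟨i + 2, h⟩ ≠ p ⟨i, by omega⟩)

/-- The number of geodesic loops (closed non-backtracking paths) of length `m`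
at `x`. -/
def cLoop (m : ℕ) (x : V) : ℕ :=
  Nat.card {p : Fin (m + 1) → V // G.IsGeoPath p ∧ p 0 = x ∧ p (Fin.last m) = x}

/-- The formal combinatorial Laplacian applied to `cLoop m`:
`(Δ_X c_m)(x) = deg(x)·c_m(x) − Σ_{y ∼ x} c_m(y)`. -/
def lapc (m : ℕ) (x : V) : ℤ :=
  (G.gdeg x : ℤ) * G.cLoop m x - ∑ᶠ y ∈ G.neighborSet x, (G.cLoop m y : ℤ)

/-- The defining property of the geodesic-path-counting operators `C_m` on
`ℓ²(V)`: `(C_m f)(x) = Σ_c f(t(c))`, the sum over all geodesic paths `c` of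
length `m` starting at `x` (so `C₀ = I` and `C₁ = A_X`). -/
def IsGeoCountOp (C : ℕ → (ℓ2 V →L[ℂ] ℓ2 V)) : Prop :=
  ∀ (m : ℕ) (f : ℓ2 V) (x : V),
    C m f x =
      ∑ᶠ p : {p : Fin (m + 1) → V // G.IsGeoPath p ∧ p 0 = x}, f (p.1 (Fin.last m))

/-- The defining property of the adjacency operator on `ℓ²(V)`:
`(A f)(x) = Σ_{y ∼ x} f(y)`. -/
def IsAdjOp (A : ℓ2 V →L[ℂ] ℓ2 V) : Prop :=
  ∀ (f : ℓ2 V) (x : V), A f x = ∑ᶠ y ∈ G.neighborSet x, f y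

/-- The defining property of the valency operator on `ℓ²(V)`:
`(D f)(x) = deg(x)·f(x)`. -/
def IsValOp (D : ℓ2 V →L[ℂ] ℓ2 V) : Prop :=
  ∀ (f : ℓ2 V) (x : V), D f x = (G.gdeg x : ℂ) * f x

end SimpleGraph

namespace SimpleGraph

variable {V : Type} (G : SimpleGraph V)

/-- The geodesic paths of length `m` starting at `x`. -/
abbrev GeoPathFrom (m : ℕ) (x : V) : Type :=
  {p : Fin (m + 1) → V // G.IsGeoPath p ∧ p 0 = x}

/-- The vertices by which a path can be prolonged at its end without backtracking. -/
def geoExt {m : ℕ} (p : Fin (m + 1) → V) : Set V :=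
  {y | G.Adj (p (Fin.last m)) y ∧ ∀ _ : 1 ≤ m, y ≠ p ⟨m - 1, by omega⟩}

theorem isGeoPath_snoc {m : ℕ} (p : Fin (m + 1) → V) (y : V) :
    G.IsGeoPath (Fin.snoc p y : Fin (m + 1 + 1) → V) ↔ G.IsGeoPath p ∧ y ∈ G.geoExt p := by
  have hlt : ∀ (i : ℕ) (h : i < m + 1), (Fin.snoc p y : Fin (m + 1 + 1) → V) ⟨i, by omega⟩
      = p ⟨i, h⟩ := fun i h => Fin.snoc_castSucc (α := fun _ => V) (i := ⟨i, h⟩) ..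
  have hlast : (Fin.snoc p y : Fin (m + 1 + 1) → V) ⟨m + 1, by omega⟩ = y :=
    Fin.snoc_last (α := fun _ => V) ..
  constructor
  · rintro ⟨h1, h2⟩
    refine ⟨⟨fun i h => ?_, fun i h => ?_⟩, ?_, fun hm => ?_⟩
    · have := h1 i (by omega)
      rwa [hlt i (by omega), hlt (i + 1) h] at this
    · have := h2 i (by omega)
      rwa [hlt i (by omega), hlt (i + 2) h] at this
    · have := h1 m (by omega)
      rwa [hlt m (by omega), hlast] at this
    · obtain ⟨k, rfl⟩ : ∃ k, m = k + 1 := ⟨m - 1, by omega⟩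
      have := h2 k (by omega)
      rwa [hlt k (by omega), hlast] at this
  · rintro ⟨⟨h1, h2⟩, h3, h4⟩
    refine ⟨fun i h => ?_, fun i h => ?_⟩
    · rcases Nat.lt_or_ge (i + 1) (m + 1) with hi | hi
      · rw [hlt i (by omega), hlt (i + 1) hi]
        exact h1 i hi
      · obtain rfl : i = m := by omega
        rw [hlt i (by omega), hlast]
        exact h3
    · rcases Nat.lt_or_ge (i + 2) (m + 1) with hi | hi
      · rw [hlt i (by omega), hlt (i + 2) hi]
        exact h2 i hi
      · obtain rfl : m = i + 1 := by omega
        rw [hlt i (by omega), hlast]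
        exact h4 (by omega)

/-- A geodesic path of length `m + 1` is a geodesic path of length `m` with a non-backtracking
prolongation. -/
def geoPathSnocEquiv (m : ℕ) (x : V) :
    (Σ p : G.GeoPathFrom m x, G.geoExt p.1) ≃ G.GeoPathFrom (m + 1) x :=
  Equiv.ofBijective
    (fun q => ⟨Fin.snoc q.1.1 q.2.1, (G.isGeoPath_snoc _ _).2 ⟨q.1.2.1, q.2.2⟩,
      (Fin.snoc_castSucc (α := fun _ => V) (i := 0) ..).trans q.1.2.2⟩) <| by
    constructor
    · rintro ⟨⟨p, hp⟩, ⟨y, hy⟩⟩ ⟨⟨p', hp'⟩, ⟨y', hy'⟩⟩ h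
      obtain ⟨rfl, rfl⟩ := Fin.snoc_injective2 (α := fun _ => V) (Subtype.ext_iff.1 h)
      rfl
    · rintro ⟨q, hq, h0⟩
      have hs : (Fin.snoc (Fin.init q) (q (Fin.last _)) : Fin (m + 1 + 1) → V) = q :=
        Fin.snoc_init_self q
      rw [← hs] at hq
      obtain ⟨h1, h2⟩ := (G.isGeoPath_snoc _ _).1 hq
      exact ⟨⟨⟨Fin.init q, h1, h0⟩, ⟨_, h2⟩⟩, Subtype.ext hs⟩

variable {G}

theorem finite_geoExt (hfin : ∀ v, (G.neighborSet v).Finite) {m : ℕ} (p : Fin (m + 1) → V) :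
    (G.geoExt p).Finite :=
  (hfin (p (Fin.last m))).subset fun _ hy => hy.1

theorem finite_geoPathFrom (hfin : ∀ v, (G.neighborSet v).Finite) (m : ℕ) (x : V) :
    Finite (G.GeoPathFrom m x) := by
  induction m with
  | zero =>
    have : Subsingleton (G.GeoPathFrom 0 x) := ⟨fun p q => Subtype.ext <| funext fun i => by
      rw [Fin.fin_one_eq_zero i, p.2.2, q.2.2]⟩
    infer_instance
  | succ m ih =>
    have : ∀ p : G.GeoPathFrom m x, Finite (G.geoExt p.1) := fun p => finite_geoExt hfin p.1
    exact Finite.of_equiv _ (G.geoPathSnocEquiv m x)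

/-- Summing over the geodesic paths of length `m + 1` amounts to summing over those of length `m`
and over their prolongations. -/
theorem finsum_geoPathFrom_succ (hfin : ∀ v, (G.neighborSet v).Finite) (m : ℕ) (x : V)
    (g : V → V → ℂ) :
    ∑ᶠ p : G.GeoPathFrom (m + 1) x, g (p.1 (Fin.last m).castSucc) (p.1 (Fin.last (m + 1))) =
      ∑ᶠ p : G.GeoPathFrom m x, ∑ᶠ y ∈ G.geoExt p.1, g (p.1 (Fin.last m)) y := by
  have := finite_geoPathFrom hfin m x
  have : ∀ p : G.GeoPathFrom m x, Finite (G.geoExt p.1) := fun p => finite_geoExt hfin p.1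
  cases nonempty_fintype (G.GeoPathFrom m x)
  have := fun p : G.GeoPathFrom m x => Fintype.ofFinite (G.geoExt p.1)
  rw [← finsum_comp_equiv (G.geoPathSnocEquiv m x), finsum_eq_sum_of_fintype,
    finsum_eq_sum_of_fintype, Fintype.sum_sigma]
  refine Finset.sum_congr rfl fun p _ => ?_
  rw [← finsum_set_coe_eq_finsum_mem, finsum_eq_sum_of_fintype]
  refine Finset.sum_congr rfl fun y _ => ?_
  change g ((Fin.snoc p.1 y.1 : Fin (m + 1 + 1) → V) _)
    ((Fin.snoc p.1 y.1 : Fin (m + 1 + 1) → V) _) = _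
  rw [Fin.snoc_castSucc, Fin.snoc_last]

theorem finsum_geoExt_zero (p : Fin 1 → V) (g : V → ℂ) :
    ∑ᶠ y ∈ G.geoExt p, g y = ∑ᶠ y ∈ G.neighborSet (p 0), g y := by
  have : G.geoExt p = G.neighborSet (p 0) := by
    ext y
    simp [geoExt]
  rw [this]

theorem finsum_geoExt_succ (hfin : ∀ v, (G.neighborSet v).Finite) {m : ℕ}
    {p : Fin (m + 1 + 1) → V} (hp : G.IsGeoPath p) (g : V → ℂ) :
    ∑ᶠ y ∈ G.geoExt p, g y =
      (∑ᶠ y ∈ G.neighborSet (p (Fin.last _)), g y) - g (p (Fin.last m).castSucc) := by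
  have hadj : G.Adj (p (Fin.last m).castSucc) (p (Fin.last (m + 1))) := hp.1 m (by omega)
  have hins : G.neighborSet (p (Fin.last _)) =
      insert (p (Fin.last m).castSucc) (G.geoExt p) := by
    ext y
    simp only [mem_neighborSet, Set.mem_insert_iff, geoExt, Set.mem_ofPred_eq]
    constructor
    · intro h
      by_cases hy : y = p (Fin.last m).castSucc
      · exact Or.inl hy
      · exact Or.inr ⟨h, fun _ => hy⟩
    · rintro (rfl | h)
      · exact hadj.symm
      · exact h.1
  have hnot : p (Fin.last m).castSucc ∉ G.geoExt p := fun h => h.2 (by omega) rfl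
  rw [hins, finsum_mem_insert _ hnot (finite_geoExt hfin p)]
  ring

theorem finsum_neighborSet_const (hfin : ∀ v, (G.neighborSet v).Finite) (v : V) (c : ℂ) :
    ∑ᶠ _y ∈ G.neighborSet v, c = (G.gdeg v : ℂ) * c := by
  rw [finsum_mem_eq_finite_toFinset_sum _ (hfin v), Finset.sum_const, nsmul_eq_mul, gdeg,
    Nat.card_coe_set_eq, Set.ncard_eq_toFinset_card _ (hfin v)]

section Operators

variable {A D : ℓ2 V →L[ℂ] ℓ2 V} {C : ℕ → (ℓ2 V →L[ℂ] ℓ2 V)}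

theorem IsGeoCountOp.zero (hC : G.IsGeoCountOp C) : C 0 = 1 := by
  ext f x
  let p₀ : G.GeoPathFrom 0 x := ⟨fun _ => x, ⟨fun i h => by omega, fun i h => by omega⟩, rfl⟩
  have : Unique (G.GeoPathFrom 0 x) := ⟨⟨p₀⟩, fun p => Subtype.ext <| funext fun i => by
    rw [Fin.fin_one_eq_zero i, p.2.2]; rfl⟩
  rw [hC, finsum_unique]
  exact congrArg f (default : G.GeoPathFrom 0 x).2.2

theorem IsGeoCountOp.one (hfin : ∀ v, (G.neighborSet v).Finite) (hA : G.IsAdjOp A)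
    (hC : G.IsGeoCountOp C) : C 1 = A := by
  ext f x
  have h0 : C 0 (A f) x = A f x := by rw [hC.zero]; rfl
  rw [← h0, hC 1, hC 0, finsum_geoPathFrom_succ hfin 0 x fun _ y => f y]
  exact finsum_congr fun p => by rw [finsum_geoExt_zero, hA]; rfl

theorem IsGeoCountOp.apply_add_two (hfin : ∀ v, (G.neighborSet v).Finite) (hA : G.IsAdjOp A)
    (hC : G.IsGeoCountOp C) (m : ℕ) (f : ℓ2 V) (x : V) :
    C (m + 2) f x = C (m + 1) (A f) x -
      ∑ᶠ p : G.GeoPathFrom m x, ∑ᶠ _y ∈ G.geoExt p.1, f (p.1 (Fin.last m)) := by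
  have := finite_geoPathFrom hfin (m + 1) x
  rw [hC (m + 2), hC (m + 1), finsum_geoPathFrom_succ hfin (m + 1) x fun _ y => f y,
    ← finsum_geoPathFrom_succ hfin m x fun z _ => f z,
    ← finsum_sub_distrib (Set.toFinite _) (Set.toFinite _)]
  exact finsum_congr fun p => by rw [finsum_geoExt_succ hfin p.2.1, hA]

theorem IsGeoCountOp.two (hfin : ∀ v, (G.neighborSet v).Finite) (hA : G.IsAdjOp A)
    (hD : G.IsValOp D) (hC : G.IsGeoCountOp C) : C 2 = A * A - D := by
  ext f x
  have h0 : C 0 (D f) x = D f x := by rw [hC.zero]; rfl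
  rw [hC.apply_add_two hfin hA 0, hC.one hfin hA]
  change _ = A (A f) x - D f x
  rw [← h0, hC 0]
  congr 1
  refine finsum_congr fun p => ?_
  rw [finsum_geoExt_zero, finsum_neighborSet_const hfin, hD]
  rfl

theorem IsGeoCountOp.add_three (hfin : ∀ v, (G.neighborSet v).Finite) (hA : G.IsAdjOp A)
    (hD : G.IsValOp D) (hC : G.IsGeoCountOp C) (m : ℕ) :
    C (m + 3) = C (m + 2) * A - C (m + 1) * (D - 1) := by
  ext f x
  rw [hC.apply_add_two hfin hA (m + 1)]
  change _ = C (m + 2) (A f) x - C (m + 1) (D f - f) x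
  rw [hC (m + 1) (D f - f)]
  congr 1
  refine finsum_congr fun p => ?_
  rw [finsum_geoExt_succ hfin p.2.1, finsum_neighborSet_const hfin]
  simp [hD f]

/-- A pointwise multiplication operator is bounded in norm by any bound on its multipliers. -/
theorem _root_.lp.norm_le_of_apply_eq_mul {T : ℓ2 V →L[ℂ] ℓ2 V} {w : V → ℂ} {c : ℝ} (hc : 0 ≤ c)
    (hw : ∀ x, ‖w x‖ ≤ c) (hT : ∀ f x, T f x = w x * f x) : ‖T‖ ≤ c := by
  refine T.opNorm_le_bound hc fun f => ?_
  refine lp.norm_le_of_forall_sum_le (by norm_num) (by positivity) fun s => ?_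
  have hf := lp.sum_rpow_le_norm_rpow (p := 2) (by norm_num) f s
  simp only [ENNReal.toReal_ofNat, Real.rpow_ofNat] at hf ⊢
  calc ∑ x ∈ s, ‖T f x‖ ^ 2 ≤ ∑ x ∈ s, c ^ 2 * ‖f x‖ ^ 2 := by
        refine Finset.sum_le_sum fun x _ => ?_
        rw [hT, norm_mul, mul_pow]
        gcongr
        exact hw x
    _ ≤ (c * ‖f‖) ^ 2 := by
        rw [← Finset.mul_sum, mul_pow]
        gcongr

theorem IsAdjOp.norm_le (hfin : ∀ v, (G.neighborSet v).Finite) {M : ℕ}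
    (hM : ∀ v, G.gdeg v ≤ M) (hA : G.IsAdjOp A) : ‖A‖ ≤ M := by
  classical
  have hcard : ∀ v, ((hfin v).toFinset.card : ℝ) ≤ M := fun v => by
    rw [← Set.ncard_eq_toFinset_card _ (hfin v), ← Nat.card_coe_set_eq]
    exact_mod_cast hM v
  refine A.opNorm_le_bound (by positivity) fun f => ?_
  refine lp.norm_le_of_forall_sum_le (by norm_num) (by positivity) fun s => ?_
  set t := s.biUnion fun x => (hfin x).toFinset with ht
  have hf := lp.sum_rpow_le_norm_rpow (p := 2) (by norm_num) f t
  simp only [ENNReal.toReal_ofNat, Real.rpow_ofNat] at hf ⊢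
  calc ∑ x ∈ s, ‖A f x‖ ^ 2 ≤ ∑ x ∈ s, M * ∑ y ∈ (hfin x).toFinset, ‖f y‖ ^ 2 := by
        refine Finset.sum_le_sum fun x _ => ?_
        rw [hA, finsum_mem_eq_finite_toFinset_sum _ (hfin x)]
        calc ‖∑ y ∈ (hfin x).toFinset, f y‖ ^ 2 ≤ (∑ y ∈ (hfin x).toFinset, ‖f y‖) ^ 2 := by
              gcongr
              exact norm_sum_le _ _
          _ ≤ (hfin x).toFinset.card * ∑ y ∈ (hfin x).toFinset, ‖f y‖ ^ 2 :=
              sq_sum_le_card_mul_sum_sq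
          _ ≤ _ := by
              exact mul_le_mul_of_nonneg_right (hcard x) (by positivity)
    _ = M * ∑ y ∈ t, ∑ x ∈ s with y ∈ (hfin x).toFinset, ‖f y‖ ^ 2 := by
        rw [← Finset.mul_sum]
        congr 1
        refine Finset.sum_comm' fun x y => ?_
        simp only [Finset.mem_filter, ht, Finset.mem_biUnion]
        exact ⟨fun h => ⟨⟨h.1, h.2⟩, x, h.1, h.2⟩, fun h => h.1⟩
    _ ≤ M * ∑ y ∈ t, M * ‖f y‖ ^ 2 := by
        gcongr with y
        rw [Finset.sum_const, nsmul_eq_mul]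
        refine mul_le_mul_of_nonneg_right (le_trans ?_ (hcard y)) (by positivity)
        gcongr
        intro x hx
        simpa [G.adj_comm] using (Finset.mem_filter.1 hx).2
    _ ≤ (M * ‖f‖) ^ 2 := by
        rw [← Finset.mul_sum, ← mul_assoc, ← sq, mul_pow]
        gcongr

end Operators

end SimpleGraph

section Recurrence

variable {R : Type*}

theorem sum_range_half_add_two [AddCommMonoid R] (C : ℕ → R) (m : ℕ) :
    ∑ k ∈ Finset.range ((m + 2) / 2 + 1), C (m + 2 - 2 * k) =
      ∑ k ∈ Finset.range (m / 2 + 1), C (m - 2 * k) + C (m + 2) := by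
  rw [show (m + 2) / 2 + 1 = m / 2 + 1 + 1 by omega, Finset.sum_range_succ']
  congr 1
  exact Finset.sum_congr rfl fun k _ => congrArg C (by omega)

theorem sum_range_half_recurrence [Ring R] {A D : R} {C : ℕ → R} (h0 : C 0 = 1) (h1 : C 1 = A)
    (h2 : C 2 = A * A - D) (h3 : ∀ m, C (m + 3) = C (m + 2) * A - C (m + 1) * (D - 1)) (m : ℕ) :
    ∑ k ∈ Finset.range ((m + 2) / 2 + 1), C (m + 2 - 2 * k) =
      (∑ k ∈ Finset.range ((m + 1) / 2 + 1), C (m + 1 - 2 * k)) * A -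
        (∑ k ∈ Finset.range (m / 2 + 1), C (m - 2 * k)) * (D - 1) := by
  induction m using Nat.twoStepInduction with
  | zero =>
    simp [Finset.sum_range_succ, h0, h1, h2]
    noncomm_ring
  | one =>
    have := h3 0
    simp [Finset.sum_range_succ, h0, h1, this]
    noncomm_ring
  | more m ih _ =>
    rw [sum_range_half_add_two C (m + 2)]
    refine (congrArg (· + _) ih).trans ?_
    rw [h3 (m + 1), sum_range_half_add_two C (m + 1), sum_range_half_add_two C m]
    noncomm_ring

theorem tsum_mul_eq_one_of_recurrence [Ring R] [TopologicalSpace R] [IsTopologicalRing R]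
    [T2Space R] {a : ℕ → R} {b c : R} (ha : Summable a) (h0 : a 0 = 1) (h1 : a 1 = b)
    (h : ∀ m, a (m + 2) = a (m + 1) * b - a m * c) : (∑' m, a m) * (1 - b + c) = 1 := by
  have ha1 : Summable fun m => a (m + 1) := (summable_nat_add_iff 1).2 ha
  have e1 : ∑' m, a m = 1 + ∑' m, a (m + 1) := by rw [ha.tsum_eq_zero_add, h0]
  have e2 : ∑' m, a (m + 1) = b + ((∑' m, a (m + 1)) * b - (∑' m, a m) * c) := by
    conv_lhs => rw [ha1.tsum_eq_zero_add, h1]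
    rw [← ha1.tsum_mul_right, ← ha.tsum_mul_right,
      ← (ha1.mul_right b).tsum_sub (ha.mul_right c)]
    simp only [h]
  have e3 : ∑' m, a (m + 1) = (∑' m, a m) - 1 := by rw [e1]; abel
  rw [e3] at e2
  calc (∑' m, a m) * (1 - b + c)
      = (∑' m, a m) - 1 - (b + (((∑' m, a m) - 1) * b - (∑' m, a m) * c)) + 1 := by noncomm_ring
    _ = 1 := by rw [← e2]; abel

theorem norm_le_pow_of_recurrence [NormedRing R] {A D : R} {C : ℕ → R} {M α : ℝ} (hM : 0 ≤ M)
    (hMα : M ≤ α) (hα : M * α + M = α ^ 2) (h0 : ‖C 0‖ ≤ 1) (h1 : C 1 = A)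
    (h2 : C 2 = A * A - D) (h3 : ∀ m, C (m + 3) = C (m + 2) * A - C (m + 1) * (D - 1))
    (hA : ‖A‖ ≤ M) (hD : ‖D‖ ≤ M) (hQ : ‖D - 1‖ ≤ M) (m : ℕ) : ‖C m‖ ≤ α ^ m := by
  have hα0 : 0 ≤ α := hM.trans hMα
  have key : ∀ m, ‖C (m + 1)‖ ≤ α ^ (m + 1) := by
    intro m
    induction m using Nat.twoStepInduction with
    | zero => simpa [h1] using hA.trans hMα
    | one =>
      calc ‖C 2‖ ≤ ‖A‖ * ‖A‖ + ‖D‖ := by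
            rw [h2]
            exact (norm_sub_le _ _).trans (by gcongr; exact norm_mul_le _ _)
        _ ≤ M * α + M := by
            gcongr
            exact hA.trans hMα
        _ = α ^ 2 := hα
    | more m ih ih' =>
      calc ‖C (m + 3)‖ ≤ ‖C (m + 2)‖ * ‖A‖ + ‖C (m + 1)‖ * ‖D - 1‖ := by
            rw [h3]
            exact (norm_sub_le _ _).trans (by gcongr <;> exact norm_mul_le _ _)
        _ ≤ α ^ (m + 2) * M + α ^ (m + 1) * M := by gcongr
        _ = α ^ (m + 1) * (M * α + M) := by ring
        _ = α ^ (m + 3) := by rw [hα]; ring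
  cases m with
  | zero => simpa using h0
  | succ m => exact key m

theorem summable_pow_smul_sum_range_half [NormedRing R] [NormedAlgebra ℂ R] [CompleteSpace R]
    {C : ℕ → R} {α : ℝ} (hα : 1 ≤ α) (hC : ∀ m, ‖C m‖ ≤ α ^ m) {u : ℂ} (hu : ‖u‖ * α < 1) :
    Summable fun m : ℕ => u ^ m • ∑ k ∈ Finset.range (m / 2 + 1), C (m - 2 * k) := by
  have hr : ‖‖u‖ * α‖ < 1 := by rwa [Real.norm_of_nonneg (by positivity)]
  refine Summable.of_norm_bounded (g := fun m : ℕ => ((m : ℝ) ^ 1 * (‖u‖ * α) ^ m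
    + (‖u‖ * α) ^ m)) ((summable_pow_mul_geometric_of_norm_lt_one 1 hr).add
      (summable_geometric_of_norm_lt_one hr)) fun m => ?_
  calc ‖u ^ m • ∑ k ∈ Finset.range (m / 2 + 1), C (m - 2 * k)‖
      ≤ ‖u‖ ^ m * ∑ k ∈ Finset.range (m / 2 + 1), α ^ m := by
        rw [norm_smul, norm_pow]
        gcongr
        refine norm_sum_le_of_le _ fun k _ => (hC _).trans ?_
        exact pow_le_pow_right₀ hα (Nat.sub_le _ _)
    _ ≤ ‖u‖ ^ m * ((m + 1) * α ^ m) := by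
        rw [Finset.sum_const, Finset.card_range, nsmul_eq_mul]
        gcongr
        exact_mod_cast Nat.succ_le_succ (Nat.div_le_self m 2)
    _ = _ := by ring

end Recurrence

/-- For `|u| < 1/α`:
`Σ_m (Σ_{k=0}^{⌊m/2⌋} C_{m−2k}) u^m` converges in operator norm and
`(Σ_m (Σ_{k=0}^{⌊m/2⌋} C_{m−2k}) u^m)(I − uA_X + u²Q_X) = I`. -/
theorem C_partial_sum_series_inverse {V : Type} (G : SimpleGraph V) [Countable V]
    (hconn : G.Connected)
    (hfin : ∀ v : V, (G.neighborSet v).Finite)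
    (hbd : ∃ M₀ : ℕ, ∀ v : V, G.gdeg v ≤ M₀)
    (hdeg1 : ∀ v : V, G.gdeg v ≠ 1)
    (M : ℕ) (hM : M = sSup (Set.range fun v : V => G.gdeg v))
    (A D : ℓ2 V →L[ℂ] ℓ2 V) (hA : G.IsAdjOp A) (hD : G.IsValOp D)
    (C : ℕ → (ℓ2 V →L[ℂ] ℓ2 V)) (hC : G.IsGeoCountOp C)
    (u : ℂ) (hu : ‖u‖ < 1 / (((M : ℝ) + Real.sqrt ((M : ℝ) ^ 2 + 4 * M)) / 2)) :
    Summable (fun m : ℕ => u ^ m • ∑ k ∈ Finset.range (m / 2 + 1), C (m - 2 * k)) ∧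
      (∑' m : ℕ, u ^ m • ∑ k ∈ Finset.range (m / 2 + 1), C (m - 2 * k)) *
          (1 - u • A + u ^ 2 • (D - 1)) = 1 := by
  have hdeg : ∀ v, G.gdeg v ≤ M := fun v => by
    obtain ⟨M₀, hM₀⟩ := hbd
    rw [hM]
    exact le_csSup ⟨M₀, by rintro _ ⟨w, rfl⟩; exact hM₀ w⟩ ⟨v, rfl⟩
  set α : ℝ := ((M : ℝ) + Real.sqrt ((M : ℝ) ^ 2 + 4 * M)) / 2 with hα
  have hM1 : 1 ≤ M := by
    rcases Nat.eq_zero_or_pos M with h | h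
    · have : α = 0 := by simp [hα, h]
      rw [this, div_zero] at hu
      exact absurd hu (not_lt.2 (norm_nonneg u))
    · exact h
  have hM1' : (1 : ℝ) ≤ M := by exact_mod_cast hM1
  have hsq : Real.sqrt ((M : ℝ) ^ 2 + 4 * M) ^ 2 = (M : ℝ) ^ 2 + 4 * M :=
    Real.sq_sqrt (by positivity)
  have hMα : (M : ℝ) ≤ α := by
    have : (M : ℝ) ≤ Real.sqrt ((M : ℝ) ^ 2 + 4 * M) := Real.le_sqrt_of_sq_le (by linarith)
    linarith
  have hα2 : M * α + M = α ^ 2 := by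
    rw [hα]
    linarith
  have hα0 : 0 < α := by linarith
  have h0 := hC.zero
  have h1 := hC.one hfin hA
  have h2 := hC.two hfin hA hD
  have h3 := hC.add_three hfin hA hD
  have hDn : ‖D‖ ≤ M := lp.norm_le_of_apply_eq_mul (by positivity)
    (fun x => by simpa using hdeg x) hD
  have hQn : ‖D - 1‖ ≤ M := by
    refine lp.norm_le_of_apply_eq_mul (w := fun x => (G.gdeg x : ℂ) - 1) (by positivity)
      (fun x => ?_) fun f x => ?_
    · have hx : (G.gdeg x : ℝ) ≤ M := by exact_mod_cast hdeg x
      have hx0 : (0 : ℝ) ≤ G.gdeg x := by positivity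
      have : ((G.gdeg x : ℂ) - 1) = (((G.gdeg x : ℝ) - 1 : ℝ) : ℂ) := by push_cast; rfl
      rw [this, Complex.norm_real, Real.norm_eq_abs, abs_le]
      constructor <;> linarith
    · change D f x - f x = _
      rw [hD]
      ring
  have hCn : ∀ m, ‖C m‖ ≤ α ^ m := norm_le_pow_of_recurrence (by positivity) hMα hα2
    (by rw [h0]; exact ContinuousLinearMap.norm_id_le) h1 h2 h3 (hA.norm_le hfin hdeg) hDn hQn
  have hsum := summable_pow_smul_sum_range_half (hM1'.trans hMα) hCn ((lt_div_iff₀ hα0).1 hu)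
  refine ⟨hsum, tsum_mul_eq_one_of_recurrence hsum (by simp [h0]) (by simp [h1]) fun m => ?_⟩
  rw [sum_range_half_recurrence h0 h1 h2 h3 m, smul_sub]
  simp only [smul_mul_assoc, mul_smul_comm, smul_smul]
  congr 2 <;> ring
end
end

section
/- Let X be a simple graph as in the context, let α = (M + √(M² + 4M))/2, and set f(u) = A_X u − Q_X u². Then for every complex number u with |u| < 1/α one has ‖f(u)‖ < 1, and f′(u)(I − f(u))^{−1} = −(d/du) log(I − f(u)) + u²·Σ_{n=1}^{∞} (1/n)·Σ_{j=1}^{n−1} j·f(u)^{n−1−j}[A_X, Q_X]f(u)^{j−1}, where log(I − f(u)) = −Σ_{n=1}^{∞} f(u)^n/n (converging in operator norm, uniformly on compact subsets of |u| < 1/α), f′(u) = A_X − 2Q_X u, and [A_X, Q_X] = A_X Q_X − Q_X A_X. -/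
noncomputable section

namespace lp

variable {ι : Type*} {E : ι → Type*} [∀ i, NormedAddCommGroup (E i)]

theorem sum_norm_sq_le_norm_sq (f : lp E 2) (s : Finset ι) :
    ∑ i ∈ s, ‖f i‖ ^ 2 ≤ ‖f‖ ^ 2 := by
  simpa using lp.sum_rpow_le_norm_rpow (p := 2) (by simp) f s

theorem norm_le_of_forall_sum_sq_le {C : ℝ} (hC : 0 ≤ C) {f : lp E 2}
    (hf : ∀ s : Finset ι, ∑ i ∈ s, ‖f i‖ ^ 2 ≤ C ^ 2) : ‖f‖ ≤ C :=
  lp.norm_le_of_forall_sum_le (p := 2) (by simp) hC (by simpa using hf)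

end lp

namespace SimpleGraph

variable {V : Type} {G : SimpleGraph V}

theorem IsAdjOp.opNorm_le {A : ℓ2 V →L[ℂ] ℓ2 V} (hA : G.IsAdjOp A)
    (hfin : ∀ v : V, (G.neighborSet v).Finite) {M : ℕ} (hM : ∀ v, G.gdeg v ≤ M) :
    ‖A‖ ≤ M := by
  classical
  let N : V → Finset V := fun v => (hfin v).toFinset
  have hN : ∀ x y, y ∈ N x ↔ G.Adj x y := fun x y => by simp [N]
  have hcard : ∀ v, (N v).card ≤ M := fun v => by
    rw [← Set.ncard_eq_toFinset_card _ (hfin v)]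
    exact hM v
  refine A.opNorm_le_bound M.cast_nonneg fun f =>
    lp.norm_le_of_forall_sum_sq_le (by positivity) fun s => ?_
  have hrow : ∀ x, ‖A f x‖ ^ 2 ≤ M * ∑ y ∈ N x, ‖f y‖ ^ 2 := fun x => by
    have hAx : A f x = ∑ y ∈ N x, f y := by
      rw [hA, finsum_mem_eq_finite_toFinset_sum _ (hfin x)]
    calc ‖A f x‖ ^ 2 ≤ (∑ y ∈ N x, ‖f y‖) ^ 2 := by
          rw [hAx]; gcongr; exact norm_sum_le _ _
      _ ≤ (N x).card * ∑ y ∈ N x, ‖f y‖ ^ 2 := sq_sum_le_card_mul_sum_sq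
      _ ≤ M * ∑ y ∈ N x, ‖f y‖ ^ 2 := by gcongr; exact hcard x
  calc ∑ x ∈ s, ‖A f x‖ ^ 2 ≤ ∑ x ∈ s, M * ∑ y ∈ N x, ‖f y‖ ^ 2 :=
        Finset.sum_le_sum fun x _ => hrow x
    _ = M * ∑ y ∈ s.biUnion N, ∑ x ∈ s with G.Adj x y, ‖f y‖ ^ 2 := by
        rw [← Finset.mul_sum]
        congr 1
        refine Finset.sum_comm' fun x y => ?_
        simp only [Finset.mem_filter, Finset.mem_biUnion, hN]
        exact ⟨fun h => ⟨h, x, h⟩, fun h => h.1⟩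
    _ ≤ M * ∑ y ∈ s.biUnion N, M * ‖f y‖ ^ 2 := by
        gcongr with y
        rw [Finset.sum_const, nsmul_eq_mul]
        gcongr
        refine (Finset.card_le_card fun x hx => ?_).trans (hcard y)
        exact (hN y x).2 (Finset.mem_filter.1 hx).2.symm
    _ ≤ M * (M * ‖f‖ ^ 2) := by
        rw [← Finset.mul_sum]
        gcongr
        exact lp.sum_norm_sq_le_norm_sq f _
    _ = (M * ‖f‖) ^ 2 := by ring

theorem IsValOp.opNorm_sub_one_le {D : ℓ2 V →L[ℂ] ℓ2 V} (hD : G.IsValOp D) {M : ℕ}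
    (hM : ∀ v, G.gdeg v ≤ M) (hM0 : M ≠ 0) : ‖D - 1‖ ≤ M := by
  refine (D - 1).opNorm_le_bound M.cast_nonneg fun f =>
    lp.norm_le_of_forall_sum_sq_le (by positivity) fun s => ?_
  have hpt : ∀ x, ‖(D - 1) f x‖ ≤ M * ‖f x‖ := fun x => by
    have hDx : (D - 1) f x = (((G.gdeg x : ℝ) - 1 : ℝ) : ℂ) * f x := by
      simp [hD f x, sub_mul]
    rw [hDx, norm_mul, Complex.norm_real, Real.norm_eq_abs]
    gcongr
    have h1 : (G.gdeg x : ℝ) ≤ M := by exact_mod_cast hM x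
    have h2 : (1 : ℝ) ≤ M := by exact_mod_cast Nat.one_le_iff_ne_zero.2 hM0
    have h3 : (0 : ℝ) ≤ G.gdeg x := Nat.cast_nonneg _
    exact abs_le.2 ⟨by linarith, by linarith⟩
  calc ∑ x ∈ s, ‖(D - 1) f x‖ ^ 2 ≤ ∑ x ∈ s, (M * ‖f x‖) ^ 2 := by
        gcongr with x; exact hpt x
    _ = M ^ 2 * ∑ x ∈ s, ‖f x‖ ^ 2 := by simp_rw [mul_pow, Finset.mul_sum]
    _ ≤ M ^ 2 * ‖f‖ ^ 2 := by gcongr; exact lp.sum_norm_sq_le_norm_sq f s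
    _ = (M * ‖f‖) ^ 2 := by ring

end SimpleGraph

theorem mul_add_mul_sq_lt_one {M r : ℝ} (hM : 0 ≤ M) (hr0 : 0 ≤ r)
    (hr : r < 1 / ((M + √(M ^ 2 + 4 * M)) / 2)) : M * r + M * r ^ 2 < 1 := by
  set α := (M + √(M ^ 2 + 4 * M)) / 2 with hα_def
  have hα0 : 0 ≤ α := by positivity
  have hα : α ^ 2 = M * α + M := by
    have := Real.sq_sqrt (show 0 ≤ M ^ 2 + 4 * M by positivity)
    rw [hα_def]
    linarith
  have hrα : r * α < 1 := by
    rcases hα0.eq_or_lt with h | h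
    · simp [← h]
    · exact (lt_div_iff₀ h).1 hr
  rcases hr0.eq_or_lt with rfl | hr0
  · simp
  rcases hα0.eq_or_lt with h | h
  · have : M = 0 := by rw [← h] at hα; linarith
    simp [this]
  · have h1 : M * r * α ^ 2 + M * r ^ 2 * α ^ 2 ≤ M * α * (r * α) + M * (r * α) := by
      nlinarith [mul_nonneg hM (mul_nonneg hr0.le hα0)]
    have hM' : 0 < M := by
      by_contra! hM'
      have : M = 0 := le_antisymm hM' hM
      rw [this] at hα
      nlinarith [pow_pos h 2]
    have h2 : (M * r + M * r ^ 2) * α ^ 2 < 1 * α ^ 2 := by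
      nlinarith [mul_pos hM' h]
    exact lt_of_mul_lt_mul_right h2 (by positivity)

section Ring

variable {R : Type*} [Ring R]

theorem pow_mul_eq_mul_pow_sub_sum {a b c : R} (h : a * b = b * a - c) (n : ℕ) :
    a ^ n * b = b * a ^ n - ∑ j ∈ Finset.range n, a ^ (n - 1 - j) * c * a ^ j := by
  induction n with
  | zero => simp
  | succ n ih =>
    have hsum : a * ∑ j ∈ Finset.range n, a ^ (n - 1 - j) * c * a ^ j =
        ∑ j ∈ Finset.range n, a ^ (n - j) * c * a ^ j := by
      rw [Finset.mul_sum]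
      refine Finset.sum_congr rfl fun j hj => ?_
      rw [Finset.mem_range] at hj
      rw [← mul_assoc, ← mul_assoc, ← pow_succ', show n - 1 - j + 1 = n - j by omega]
    rw [pow_succ', mul_assoc, ih, mul_sub, hsum, ← mul_assoc, h, Finset.sum_range_succ]
    simp only [Nat.add_sub_cancel, Nat.sub_self, pow_zero, one_mul]
    noncomm_ring

theorem sum_pow_mul_mul_pow {a b c : R} (h : a * b = b * a - c) (n : ℕ) :
    ∑ i ∈ Finset.range (n + 1), a ^ (n - i) * b * a ^ i =
      ((n : R) + 1) * (b * a ^ n) -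
        ∑ j ∈ Finset.Icc 1 n, (j : R) * (a ^ (n - j) * c * a ^ (j - 1)) := by
  induction n with
  | zero => simp
  | succ n ih =>
    have hL : ∑ i ∈ Finset.range (n + 1 + 1), a ^ (n + 1 - i) * b * a ^ i =
        (∑ i ∈ Finset.range (n + 1), a ^ (n - i) * b * a ^ i) * a + a ^ (n + 1) * b := by
      rw [Finset.sum_range_succ', Finset.sum_mul]
      simp [pow_succ, mul_assoc]
    have hS : (∑ j ∈ Finset.Icc 1 n, (j : R) * (a ^ (n - j) * c * a ^ (j - 1))) * a +
        ∑ j ∈ Finset.range (n + 1), a ^ (n - j) * c * a ^ j =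
        ∑ j ∈ Finset.Icc 1 (n + 1), (j : R) * (a ^ (n + 1 - j) * c * a ^ (j - 1)) := by
      have hIcc : ∀ (m : ℕ) (F : ℕ → R),
          ∑ j ∈ Finset.Icc 1 m, F j = ∑ j ∈ Finset.range m, F (j + 1) := fun m F => by
        rw [Finset.range_eq_Ico, Finset.sum_Ico_add' F 0 m 1]
        rfl
      rw [hIcc, hIcc]
      have hsplit : ∑ j ∈ Finset.range (n + 1), (j : R) * (a ^ (n - j) * c * a ^ j) =
          (∑ j ∈ Finset.range n,
            ((j + 1 : ℕ) : R) * (a ^ (n - (j + 1)) * c * a ^ (j + 1 - 1))) * a := by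
        rw [Finset.sum_range_succ', Finset.sum_mul]
        simp [pow_succ, mul_assoc]
      rw [← hsplit, ← Finset.sum_add_distrib]
      refine Finset.sum_congr rfl fun j _ => ?_
      rw [Nat.cast_succ, add_mul, one_mul, Nat.add_sub_add_right, Nat.add_sub_cancel]
    rw [hL, ih, pow_mul_eq_mul_pow_sub_sum h, ← hS, sub_mul]
    push_cast
    simp only [pow_succ]
    noncomm_ring

end Ring

theorem norm_sum_pow_mul_mul_pow_le {R : Type*} [NormedRing R] [NormOneClass R] {a b : R}
    {q K : ℝ} (ha : ‖a‖ ≤ q) (hb : ‖b‖ ≤ K) (n : ℕ) :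
    ‖∑ i ∈ Finset.range (n + 1), a ^ (n - i) * b * a ^ i‖ ≤ (n + 1) * (K * q ^ n) := by
  have hq : 0 ≤ q := (norm_nonneg a).trans ha
  have hK : 0 ≤ K := (norm_nonneg b).trans hb
  have hterm : ∀ i ∈ Finset.range (n + 1), ‖a ^ (n - i) * b * a ^ i‖ ≤ K * q ^ n := by
    intro i hi
    have hpow : ∀ k, ‖a ^ k‖ ≤ q ^ k := fun k => (norm_pow_le a k).trans (by gcongr)
    calc ‖a ^ (n - i) * b * a ^ i‖ ≤ ‖a ^ (n - i)‖ * ‖b‖ * ‖a ^ i‖ := norm_mul₃_le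
      _ ≤ q ^ (n - i) * K * q ^ i := by gcongr <;> exact hpow _
      _ = K * q ^ n := by
        rw [← Nat.sub_add_cancel (Finset.mem_range_succ_iff.1 hi), Nat.add_sub_cancel, pow_add]
        ring
  simpa using norm_sum_le_of_le _ hterm

theorem norm_inv_natCast_add_one {𝕜 : Type*} [RCLike 𝕜] (n : ℕ) :
    ‖((n : 𝕜) + 1)⁻¹‖ = ((n : ℝ) + 1)⁻¹ := by
  rw [norm_inv, ← Nat.cast_succ, RCLike.norm_natCast, Nat.cast_succ]

section LogSeries

variable {𝕜 R : Type*} [RCLike 𝕜] [NormedRing R] [NormOneClass R] [NormedAlgebra 𝕜 R]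

theorem norm_inv_smul_sum_pow_mul_mul_pow_le {a b : R} {q K : ℝ} (ha : ‖a‖ ≤ q) (hb : ‖b‖ ≤ K)
    (n : ℕ) :
    ‖((n : 𝕜) + 1)⁻¹ • ∑ i ∈ Finset.range (n + 1), a ^ (n - i) * b * a ^ i‖ ≤ K * q ^ n := by
  rw [norm_smul, norm_inv_natCast_add_one, inv_mul_le_iff₀ (by positivity)]
  exact norm_sum_pow_mul_mul_pow_le ha hb n

variable [CompleteSpace R]

theorem summable_inv_smul_pow {a : R} (ha : ‖a‖ < 1) :
    Summable fun n : ℕ => ((n : 𝕜) + 1)⁻¹ • a ^ (n + 1) := by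
  refine .of_norm_bounded
    ((summable_nat_add_iff 1).2 (summable_geometric_of_lt_one (norm_nonneg a) ha)) fun n => ?_
  rw [norm_smul, norm_inv_natCast_add_one]
  refine (mul_le_of_le_one_left (norm_nonneg _) (inv_le_one_of_one_le₀ ?_)).trans (norm_pow_le a _)
  exact le_add_of_nonneg_left n.cast_nonneg

theorem summable_inv_smul_sum_pow_mul_mul_pow {a : R} (ha : ‖a‖ < 1) (b : R) :
    Summable fun n : ℕ =>
      ((n : 𝕜) + 1)⁻¹ • ∑ i ∈ Finset.range (n + 1), a ^ (n - i) * b * a ^ i :=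
  .of_norm_bounded ((summable_geometric_of_lt_one (norm_nonneg a) ha).mul_left ‖b‖)
    (norm_inv_smul_sum_pow_mul_mul_pow_le le_rfl le_rfl)

theorem hasDerivAt_tsum_inv_smul_pow {f f' : 𝕜 → R} {u : 𝕜} (hf : ∀ z, HasDerivAt f (f' z) z)
    (hf' : ContinuousAt f' u) (hu : ‖f u‖ < 1) :
    HasDerivAt (fun z => ∑' n : ℕ, ((n : 𝕜) + 1)⁻¹ • f z ^ (n + 1))
      (∑' n : ℕ, ((n : 𝕜) + 1)⁻¹ •
        ∑ i ∈ Finset.range (n + 1), f u ^ (n - i) * f' u * f u ^ i) u := by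
  obtain ⟨q, hq, hq1⟩ := exists_between hu
  obtain ⟨ε, hε, hball⟩ := Metric.eventually_nhds_iff_ball.1
    (((hf u).continuousAt.norm.eventually_lt_const hq).and
      (hf'.norm.eventually_lt_const (lt_add_one ‖f' u‖)))
  exact hasDerivAt_tsum_of_isPreconnected
    (g := fun (n : ℕ) z => ((n : 𝕜) + 1)⁻¹ • f z ^ (n + 1))
    (g' := fun (n : ℕ) z => ((n : 𝕜) + 1)⁻¹ •
      ∑ i ∈ Finset.range (n + 1), f z ^ (n - i) * f' z * f z ^ i)
    ((summable_geometric_of_lt_one ((norm_nonneg _).trans hq.le) hq1).mul_left (‖f' u‖ + 1))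
    Metric.isOpen_ball Metric.isPreconnected_ball
    (fun n z _ => ((hf z).fun_pow' (n + 1)).fun_const_smul _)
    (fun n z hz => norm_inv_smul_sum_pow_mul_mul_pow_le (hball z hz).1.le (hball z hz).2.le n)
    (Metric.mem_ball_self hε) (summable_inv_smul_pow hu) (Metric.mem_ball_self hε)

theorem tsum_inv_smul_sum_pow_mul_mul_pow {a b c : R} {t : 𝕜} (h : a * b = b * a - t • c)
    (ha : ‖a‖ < 1) :
    ∑' n : ℕ, ((n : 𝕜) + 1)⁻¹ • ∑ i ∈ Finset.range (n + 1), a ^ (n - i) * b * a ^ i =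
      b * Ring.inverse (1 - a) - t • ∑' n : ℕ, ((n : 𝕜) + 1)⁻¹ •
        ∑ j ∈ Finset.Icc 1 n, (j : 𝕜) • (a ^ (n - j) * c * a ^ (j - 1)) := by
  have hgeom := (summable_geometric_of_norm_lt_one ha).mul_left b
  have hterm : ∀ n : ℕ, t • ((n : 𝕜) + 1)⁻¹ •
        ∑ j ∈ Finset.Icc 1 n, (j : 𝕜) • (a ^ (n - j) * c * a ^ (j - 1)) =
      b * a ^ n - ((n : 𝕜) + 1)⁻¹ •
        ∑ i ∈ Finset.range (n + 1), a ^ (n - i) * b * a ^ i := by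
    intro n
    have hn : (n : 𝕜) + 1 ≠ 0 := Nat.cast_add_one_ne_zero n
    have hcast : ((n : R) + 1) * (b * a ^ n) = ((n : 𝕜) + 1) • (b * a ^ n) := by
      rw [add_smul, one_smul, Nat.cast_smul_eq_nsmul, nsmul_eq_mul, add_mul, one_mul]
    rw [sum_pow_mul_mul_pow h, hcast, smul_sub, inv_smul_smul₀ hn, sub_sub_cancel, smul_comm]
    congr 1
    rw [Finset.smul_sum]
    refine Finset.sum_congr rfl fun j _ => ?_
    rw [smul_comm, Nat.cast_smul_eq_nsmul, nsmul_eq_mul, mul_smul_comm t (a ^ (n - j)),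
      smul_mul_assoc, mul_smul_comm]
  rw [← tsum_const_smul'', tsum_congr hterm,
    hgeom.tsum_sub (summable_inv_smul_sum_pow_mul_mul_pow ha b),
    (summable_geometric_of_norm_lt_one ha).tsum_mul_left, geom_series_eq_inverse a ha,
    sub_sub_cancel]

theorem hasDerivAt_tsum_inv_smul_sub_pow (A Q : R) {u : 𝕜} (h : ‖u • A - u ^ 2 • Q‖ < 1) :
    HasDerivAt (fun z : 𝕜 => ∑' n : ℕ, ((n : 𝕜) + 1)⁻¹ • (z • A - z ^ 2 • Q) ^ (n + 1))
      ((A - (2 * u) • Q) * Ring.inverse (1 - (u • A - u ^ 2 • Q)) -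
        u ^ 2 • ∑' n : ℕ, ((n : 𝕜) + 1)⁻¹ •
          ∑ j ∈ Finset.Icc 1 n, (j : 𝕜) •
            ((u • A - u ^ 2 • Q) ^ (n - j) * (A * Q - Q * A) *
              (u • A - u ^ 2 • Q) ^ (j - 1))) u := by
  have hderiv : ∀ z : 𝕜, HasDerivAt (fun z : 𝕜 => z • A - z ^ 2 • Q)
      (A - (2 * z) • Q) z := fun z => by
    simpa using ((hasDerivAt_id z).smul_const A).fun_sub ((hasDerivAt_pow 2 z).smul_const Q)
  have hcomm : (u • A - u ^ 2 • Q) * (A - (2 * u) • Q) =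
      (A - (2 * u) • Q) * (u • A - u ^ 2 • Q) -
        u ^ 2 • (A * Q - Q * A) := by
    simp only [sub_mul, mul_sub, smul_mul_assoc, mul_smul_comm, smul_sub, smul_smul]
    module
  rw [← tsum_inv_smul_sum_pow_mul_mul_pow hcomm h]
  exact hasDerivAt_tsum_inv_smul_pow hderiv (by fun_prop) h

end LogSeries

/-- For `f(u) = A_X u − Q_X u²` and `|u| < 1/α`: `‖f(u)‖ < 1` and
`f′(u)(I − f(u))^{−1} = −(d/du) log(I − f(u))
  + u²·Σ_{n≥1} (1/n)·Σ_{j=1}^{n−1} j·f(u)^{n−1−j}[A_X, Q_X]f(u)^{j−1}`,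
where `log(I − f(u)) = −Σ_{n≥1} f(u)^n/n`.  Equivalently (as stated below),
the function `z ↦ Σ_{n≥1} f(z)^n/n = −log(I − f(z))` has derivative at `u`
equal to `f′(u)(I − f(u))^{−1} − u²·Σ_{n≥1} (1/n)·Σ_{j=1}^{n−1}
j·f(u)^{n−1−j}[A_X, Q_X]f(u)^{j−1}`.  (Series over `n ≥ 1` are indexed below
by `n : ℕ` via `n + 1`.) -/
theorem log_deriv_formula {V : Type} (G : SimpleGraph V) [Countable V]
    (hconn : G.Connected)
    (hfin : ∀ v : V, (G.neighborSet v).Finite)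
    (hbd : ∃ M₀ : ℕ, ∀ v : V, G.gdeg v ≤ M₀)
    (hdeg1 : ∀ v : V, G.gdeg v ≠ 1)
    (M : ℕ) (hM : M = sSup (Set.range fun v : V => G.gdeg v))
    (A D : ℓ2 V →L[ℂ] ℓ2 V) (hA : G.IsAdjOp A) (hD : G.IsValOp D)
    (u : ℂ) (hu : ‖u‖ < 1 / (((M : ℝ) + Real.sqrt ((M : ℝ) ^ 2 + 4 * M)) / 2)) :
    ‖u • A - u ^ 2 • (D - 1)‖ < 1 ∧
      HasDerivAt
        (fun z : ℂ => ∑' n : ℕ, ((n : ℂ) + 1)⁻¹ • (z • A - z ^ 2 • (D - 1)) ^ (n + 1))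
        ((A - (2 * u) • (D - 1)) * Ring.inverse (1 - (u • A - u ^ 2 • (D - 1))) -
          u ^ 2 • ∑' n : ℕ, ((n : ℂ) + 1)⁻¹ •
            ∑ j ∈ Finset.Icc 1 n, (j : ℂ) •
              ((u • A - u ^ 2 • (D - 1)) ^ (n - j) *
                (A * (D - 1) - (D - 1) * A) *
                (u • A - u ^ 2 • (D - 1)) ^ (j - 1)))
        u := by
  have hgdeg : ∀ v, G.gdeg v ≤ M := by
    obtain ⟨M₀, hM₀⟩ := hbd
    exact fun v => hM ▸ le_csSup ⟨M₀, Set.forall_mem_range.2 hM₀⟩ ⟨v, rfl⟩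
  have hM0 : M ≠ 0 := by
    rintro rfl
    simp [(norm_nonneg u).not_gt] at hu
  have hnorm : ‖u • A - u ^ 2 • (D - 1)‖ < 1 := by
    calc ‖u • A - u ^ 2 • (D - 1)‖ ≤ ‖u‖ * ‖A‖ + ‖u‖ ^ 2 * ‖D - 1‖ := by
          refine (norm_sub_le _ _).trans_eq ?_
          rw [norm_smul, norm_smul, norm_pow]
      _ ≤ ‖u‖ * M + ‖u‖ ^ 2 * M := by
          gcongr
          · exact hA.opNorm_le hfin hgdeg
          · exact hD.opNorm_sub_one_le hgdeg hM0
      _ = M * ‖u‖ + M * ‖u‖ ^ 2 := by ring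
      _ < 1 := mul_add_mul_sq_lt_one M.cast_nonneg (norm_nonneg u) hu
  have : Nontrivial (ℓ2 V) := by
    classical
    obtain ⟨v⟩ := hconn.nonempty
    refine ⟨lp.single 2 v 1, 0, fun h => ?_⟩
    simpa using congrArg (fun f : ℓ2 V => f v) h
  exact ⟨hnorm, hasDerivAt_tsum_inv_smul_sub_pow A (D - 1) hnorm⟩
end
end
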